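/- arXiv:1907.05784 — 2 statements merged into one kernel-verified Lean document; each statement's English description precedes it below -/
import Mathlib

section
/- For all p, q ∈ ℝ³ the relative momentum satisfies the coercive inequality |p−q|/√(p⁰q⁰) ≤ g(p^μ,q^μ) ≤ |p−q|; equivalently, |p−q|²/(p⁰q⁰) ≤ |p−q|² − (p⁰−q⁰)² ≤ |p−q|². -/
noncomputable section

open Real

/-- Momentum space `ℝ³`. -/
abbrev R3 := EuclideanSpace ℝ (Fin 3)

/-- The energy `p⁰ = √(1+|p|²)` of a particle with momentum `p`. -/
def energy (p : R3) : ℝ := Real.sqrt (1 + ‖p‖ ^ 2)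

/-- The relative momentum `g(p^μ,q^μ) = √(|p−q|² − (p⁰−q⁰)²)`. -/
def relg (p q : R3) : ℝ := Real.sqrt (‖p - q‖ ^ 2 - (energy p - energy q) ^ 2)

lemma energy_pos (p : R3) : 0 < energy p := Real.sqrt_pos.2 (by positivity)

lemma energy_sq (p : R3) : energy p ^ 2 = 1 + ‖p‖ ^ 2 := Real.sq_sqrt (by positivity)

lemma norm_sub_sq_le_energy_mul (p q : R3) :
    ‖p - q‖ ^ 2 ≤ (‖p - q‖ ^ 2 - (energy p - energy q) ^ 2) * (energy p * energy q) := by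
  have hd : inner ℝ p q ^ 2 ≤ ‖p‖ ^ 2 * ‖q‖ ^ 2 := by
    rw [← mul_pow, sq_le_sq, abs_of_nonneg (by positivity : 0 ≤ ‖p‖ * ‖q‖)]
    exact abs_real_inner_le_norm p q
  have hp : ‖p‖ ^ 2 = energy p ^ 2 - 1 := by rw [energy_sq]; ring
  have hq : ‖q‖ ^ 2 = energy q ^ 2 - 1 := by rw [energy_sq]; ring
  rw [norm_sub_sq_real]
  rw [hp, hq] at hd ⊢
  linarith [sq_nonneg (energy p * energy q - 1 - inner ℝ p q)]

/-- For all `p, q ∈ ℝ³` the relative momentum satisfies the coercive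
inequality `|p−q|/√(p⁰q⁰) ≤ g(p^μ,q^μ) ≤ |p−q|`; equivalently,
`|p−q|²/(p⁰q⁰) ≤ |p−q|² − (p⁰−q⁰)² ≤ |p−q|²`. -/
theorem coercive_inequality (p q : R3) :
    (‖p - q‖ / Real.sqrt (energy p * energy q) ≤ relg p q ∧ relg p q ≤ ‖p - q‖) ∧
    (‖p - q‖ ^ 2 / (energy p * energy q) ≤ ‖p - q‖ ^ 2 - (energy p - energy q) ^ 2 ∧
      ‖p - q‖ ^ 2 - (energy p - energy q) ^ 2 ≤ ‖p - q‖ ^ 2) := by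
  have hpq : 0 < energy p * energy q := mul_pos (energy_pos p) (energy_pos q)
  have hlower : ‖p - q‖ ^ 2 / (energy p * energy q) ≤
      ‖p - q‖ ^ 2 - (energy p - energy q) ^ 2 :=
    (div_le_iff₀ hpq).2 (norm_sub_sq_le_energy_mul p q)
  have hupper : ‖p - q‖ ^ 2 - (energy p - energy q) ^ 2 ≤ ‖p - q‖ ^ 2 :=
    sub_le_self _ (sq_nonneg _)
  refine ⟨⟨Real.le_sqrt_of_sq_le ?_, Real.sqrt_le_iff.2 ⟨norm_nonneg _, hupper⟩⟩, hlower, hupper⟩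
  rwa [div_pow, Real.sq_sqrt hpq.le]
end
end

section
/- For all p, q ∈ ℝ³, every element of the first row of the Lorentz matrix Λ is bounded as |Λ⁰_ν| ≤ √2 (p⁰q⁰)^{1/2} for ν = 0,1,2,3; explicitly, (p⁰+q⁰)/√s ≤ √2 (p⁰q⁰)^{1/2} and |p^j+q^j|/√s ≤ √2 (p⁰q⁰)^{1/2} for j = 1,2,3. -/
noncomputable section

open Real

/-- `s(p^μ,q^μ) = (p⁰+q⁰)² − |p+q|²`. -/
def sfn (p q : R3) : ℝ := (energy p + energy q) ^ 2 - ‖p + q‖ ^ 2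

lemma one_le_energy (p : R3) : 1 ≤ energy p :=
  Real.one_le_sqrt.2 (by nlinarith [sq_nonneg ‖p‖])

lemma one_add_norm_mul_norm_le (p q : R3) : 1 + ‖p‖ * ‖q‖ ≤ energy p * energy q := by
  have hp := one_le_energy p
  have hq := one_le_energy q
  refine abs_le_of_sq_le_sq' ?_ (by positivity) |>.2
  rw [mul_pow, energy_sq, energy_sq]
  nlinarith [sq_nonneg (‖p‖ - ‖q‖)]

lemma le_sfn (p q : R3) : 2 * (1 + energy p * energy q - ‖p‖ * ‖q‖) ≤ sfn p q := by
  have h := pow_le_pow_left₀ (norm_nonneg _) (norm_add_le p q) 2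
  unfold sfn
  nlinarith [energy_sq p, energy_sq q]

lemma four_le_sfn (p q : R3) : 4 ≤ sfn p q := by
  linarith [le_sfn p q, one_add_norm_mul_norm_le p q]

lemma energy_add_sq_le (p q : R3) :
    (energy p + energy q) ^ 2 ≤ 2 * (energy p * energy q) * sfn p q := by
  have hab := one_add_norm_mul_norm_le p q
  have hxy : 0 ≤ ‖p‖ * ‖q‖ := by positivity
  have hfac : (energy p + energy q) ^ 2 =
      (1 + energy p * energy q - ‖p‖ * ‖q‖) * (1 + energy p * energy q + ‖p‖ * ‖q‖) := by
    linear_combination (1 - energy q ^ 2) * energy_sq p - ‖p‖ ^ 2 * energy_sq q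
  calc (energy p + energy q) ^ 2
      ≤ sfn p q * (2 * (energy p * energy q)) := by
        rw [hfac]
        exact mul_le_mul (by linarith [le_sfn p q]) (by linarith) (by linarith)
          (by linarith [four_le_sfn p q])
    _ = _ := mul_comm _ _

lemma energy_add_div_sqrt_sfn_le (p q : R3) :
    (energy p + energy q) / Real.sqrt (sfn p q) ≤
      Real.sqrt 2 * Real.sqrt (energy p * energy q) := by
  have hs := four_le_sfn p q
  have hab := one_add_norm_mul_norm_le p q
  have hxy : 0 ≤ ‖p‖ * ‖q‖ := by positivity
  rw [div_le_iff₀ (Real.sqrt_pos.2 (by linarith)), ← Real.sqrt_mul (by norm_num),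
    ← Real.sqrt_mul (by linarith)]
  exact Real.le_sqrt_of_sq_le (energy_add_sq_le p q)

lemma abs_apply_add_le_energy_add (p q : R3) (j : Fin 3) :
    |p j + q j| ≤ energy p + energy q := by
  have h (v : R3) : |v j| ≤ energy v :=
    (PiLp.norm_apply_le v j).trans (Real.le_sqrt_of_sq_le (by linarith))
  exact (abs_add_le _ _).trans (add_le_add (h p) (h q))

/-- For all `p, q ∈ ℝ³`, every element of the first row of the Lorentz
matrix `Λ` is bounded as `|Λ⁰_ν| ≤ √2 (p⁰q⁰)^{1/2}` for `ν = 0,1,2,3`; explicitly,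
`(p⁰+q⁰)/√s ≤ √2 (p⁰q⁰)^{1/2}` and `|pʲ+qʲ|/√s ≤ √2 (p⁰q⁰)^{1/2}` for `j = 1,2,3`. -/
theorem lorentz_first_row_bound (p q : R3) :
    (energy p + energy q) / Real.sqrt (sfn p q) ≤
      Real.sqrt 2 * Real.sqrt (energy p * energy q) ∧
    ∀ j : Fin 3, |p j + q j| / Real.sqrt (sfn p q) ≤
      Real.sqrt 2 * Real.sqrt (energy p * energy q) :=
  ⟨energy_add_div_sqrt_sfn_le p q, fun j =>
    (div_le_div_of_nonneg_right (abs_apply_add_le_energy_add p q j) (Real.sqrt_nonneg _)).trans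
      (energy_add_div_sqrt_sfn_le p q)⟩
end
end
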